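/- arXiv:2001.06176 — 6 statements merged into one kernel-verified Lean document; each statement's English description precedes it below -/
import Mathlib

section
/- Let φ : ℝ → ℝ be convex on [0,1] and suppose φ has a unique minimizer t* over [0,1] with t* < 1, φ(t*) = 0 and φ(1) = 1. Then for every z ∈ ℝ^p, the minimum of Σ_{i=1}^p φ(w_i) over all w ∈ [0,1]^p satisfying Σ_{i=1}^p (1−w_i)|z_i| = 0 is attained and equals ‖z‖₀. -/
open scoped BigOperators

/-- The "zero norm": number of nonzero entries of a vector. -/
noncomputable def znorm {p : ℕ} (z : Fin p → ℝ) : ℕ :=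
  (Finset.univ.filter (fun i => z i ≠ 0)).card

/-- for φ convex on [0,1] with unique minimizer t* < 1, φ(t*)=0, φ(1)=1,
the minimum of ∑ φ(wᵢ) over w ∈ [0,1]^p with ∑ (1-wᵢ)|zᵢ| = 0 is attained and equals ‖z‖₀. -/
theorem stmt0 {p : ℕ} (φ : ℝ → ℝ) (tstar : ℝ)
    (hconv : ConvexOn ℝ (Set.Icc (0:ℝ) 1) φ)
    (htmem : tstar ∈ Set.Icc (0:ℝ) 1)
    (huniq : ∀ t ∈ Set.Icc (0:ℝ) 1, t ≠ tstar → φ tstar < φ t)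
    (htlt : tstar < 1) (hφt : φ tstar = 0) (hφ1 : φ 1 = 1)
    (z : Fin p → ℝ) :
    IsLeast {v : ℝ | ∃ w : Fin p → ℝ, (∀ i, w i ∈ Set.Icc (0:ℝ) 1) ∧
      (∑ i, (1 - w i) * |z i|) = 0 ∧ v = ∑ i, φ (w i)} (znorm z) := by
  have hcard : (znorm z : ℝ) = ∑ i, if z i ≠ 0 then (1 : ℝ) else 0 := by
    rw [Finset.sum_boole, znorm]
  rw [hcard]
  constructor
  · refine ⟨fun i => if z i ≠ 0 then 1 else tstar, fun i => ?_, ?_, ?_⟩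
    · dsimp only
      split_ifs
      · exact ⟨zero_le_one, le_rfl⟩
      · exact htmem
    · refine Finset.sum_eq_zero fun i _ => ?_
      by_cases h : z i = 0 <;> simp [h]
    · refine Finset.sum_congr rfl fun i _ => ?_
      by_cases h : z i = 0 <;> simp [h, hφt, hφ1]
  · rintro v ⟨w, hw, hsum, rfl⟩
    have hzero := (Finset.sum_eq_zero_iff_of_nonneg fun i _ =>
      mul_nonneg (sub_nonneg.2 (hw i).2) (abs_nonneg (z i))).1 hsum
    refine Finset.sum_le_sum fun i _ => ?_
    split_ifs with h
    · have hwi : w i = 1 := by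
        rcases mul_eq_zero.1 (hzero i (Finset.mem_univ i)) with h1 | h1
        · linarith
        · exact absurd (abs_eq_zero.1 h1) h
      rw [hwi, hφ1]
    · by_cases ht : w i = tstar
      · rw [ht, hφt]
      · exact hφt ▸ (huniq (w i) (hw i) ht).le
end

section
/- Let f : ℝⁿ → ℝ be continuous and nonnegative, Ω ⊆ ℝ^p nonempty and closed, A ∈ ℝ^{n×p}, b ∈ ℝⁿ, μ > 0, ν > 0, and F_μ(x) = f(Ax−b) + (μ/2)‖x‖². Let φ : ℝ → ℝ be convex on [0,1] with a unique minimizer t* over [0,1] satisfying t* < 1, φ(t*) = 0 and φ(1) = 1. Consider (P): minimize F_μ(x) + ν‖x‖₀ over x ∈ Ω, and (M): minimize F_μ(x) + ν Σ_{i=1}^p φ(w_i) over (x,w) ∈ Ω × [0,1]^p subject to Σ_{i=1}^p (1−w_i)|x_i| = 0. Then: (i) both problems attain their optimal values and these values are equal; (ii) if (x*,w*) is a global minimizer of (M), then x* is a global minimizer of (P); (iii) if x* is a global minimizer of (P), then (x*,w*) is a global minimizer of (M), where w*_i = 1 if x*_i ≠ 0 and w*_i = t* if x*_i = 0. -/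
open scoped BigOperators

/-- F_μ(x) = f(Ax - b) + (μ/2)‖x‖². -/
noncomputable def Fmu {n p : ℕ} (f : (Fin n → ℝ) → ℝ) (A : Matrix (Fin n) (Fin p) ℝ)
    (b : Fin n → ℝ) (μ : ℝ) (x : Fin p → ℝ) : ℝ :=
  f (A.mulVec x - b) + μ / 2 * ∑ i, (x i) ^ 2

/-- Objective of problem (P). -/
noncomputable def Pobj {n p : ℕ} (f : (Fin n → ℝ) → ℝ) (A : Matrix (Fin n) (Fin p) ℝ)
    (b : Fin n → ℝ) (μ ν : ℝ) (x : Fin p → ℝ) : ℝ :=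
  Fmu f A b μ x + ν * znorm x

/-- Objective of problem (M). -/
noncomputable def Mobj {n p : ℕ} (f : (Fin n → ℝ) → ℝ) (A : Matrix (Fin n) (Fin p) ℝ)
    (b : Fin n → ℝ) (μ ν : ℝ) (φ : ℝ → ℝ) (x w : Fin p → ℝ) : ℝ :=
  Fmu f A b μ x + ν * ∑ i, φ (w i)

/-- Feasibility for problem (M). -/
def MFeas {p : ℕ} (Ω : Set (Fin p → ℝ)) (x w : Fin p → ℝ) : Prop :=
  x ∈ Ω ∧ (∀ i, w i ∈ Set.Icc (0:ℝ) 1) ∧ (∑ i, (1 - w i) * |x i|) = 0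

theorem znorm_eq_sum {p : ℕ} (x : Fin p → ℝ) :
    (znorm x : ℝ) = ∑ i, if x i ≠ 0 then (1 : ℝ) else 0 := by
  rw [znorm, Finset.sum_boole]

theorem lowerSemicontinuous_znorm {p : ℕ} :
    LowerSemicontinuous (fun x : Fin p → ℝ => (znorm x : ℝ)) := by
  have hind : ∀ i : Fin p,
      LowerSemicontinuous (fun x : Fin p → ℝ => if x i ≠ 0 then (1 : ℝ) else 0) := by
    intro i
    have hopen : IsOpen {x : Fin p → ℝ | x i ≠ 0} :=
      isOpen_ne_fun (continuous_apply i) continuous_const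
    convert hopen.lowerSemicontinuous_indicator (zero_le_one (α := ℝ)) using 2 with x
    simp [Set.indicator_apply]
  simp only [znorm_eq_sum]
  exact lowerSemicontinuous_sum fun i _ => hind i

theorem continuous_Fmu {n p : ℕ} {f : (Fin n → ℝ) → ℝ} (A : Matrix (Fin n) (Fin p) ℝ)
    (b : Fin n → ℝ) (μ : ℝ) (hf : Continuous f) : Continuous (Fmu f A b μ) := by
  unfold Fmu
  have hA : Continuous fun x : Fin p → ℝ => A.mulVec x - b :=
    (Continuous.matrix_mulVec continuous_const continuous_id).sub continuous_const
  exact (hf.comp hA).add (by fun_prop)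

theorem lowerSemicontinuous_Pobj {n p : ℕ} {f : (Fin n → ℝ) → ℝ}
    (A : Matrix (Fin n) (Fin p) ℝ) (b : Fin n → ℝ) (μ : ℝ) {ν : ℝ} (hf : Continuous f)
    (hν : 0 ≤ ν) : LowerSemicontinuous (Pobj f A b μ ν) := by
  refine (continuous_Fmu A b μ hf).lowerSemicontinuous.add ?_
  exact (continuous_const_mul ν).comp_lowerSemicontinuous lowerSemicontinuous_znorm
    (monotone_mul_left_of_nonneg hν)

theorem sum_sq_le_Pobj {n p : ℕ} {f : (Fin n → ℝ) → ℝ} (A : Matrix (Fin n) (Fin p) ℝ)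
    (b : Fin n → ℝ) (μ : ℝ) {ν : ℝ} (hfnn : ∀ z, 0 ≤ f z) (hν : 0 ≤ ν) (x : Fin p → ℝ) :
    μ / 2 * ∑ i, (x i) ^ 2 ≤ Pobj f A b μ ν x := by
  have h1 := hfnn (A.mulVec x - b)
  have h2 : 0 ≤ ν * (znorm x : ℝ) := by positivity
  unfold Pobj Fmu
  linarith

theorem isCompact_sum_sq_le {p : ℕ} {μ : ℝ} (hμ : 0 < μ) (c : ℝ) :
    IsCompact {x : Fin p → ℝ | μ / 2 * ∑ i, (x i) ^ 2 ≤ c} := by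
  refine Metric.isCompact_of_isClosed_isBounded
    (isClosed_le (by fun_prop) continuous_const) ?_
  refine (Metric.isBounded_closedBall (x := (0 : Fin p → ℝ))
    (r := √(2 * c / μ))).subset fun x hx => ?_
  rw [mem_closedBall_zero_iff, pi_norm_le_iff_of_nonneg (Real.sqrt_nonneg _)]
  intro i
  refine Real.abs_le_sqrt ?_
  have hi : (x i) ^ 2 ≤ ∑ j, (x j) ^ 2 :=
    Finset.single_le_sum (f := fun j => (x j) ^ 2) (fun j _ => sq_nonneg _) (Finset.mem_univ i)
  have hx' : μ / 2 * ∑ j, (x j) ^ 2 ≤ c := hx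
  rw [le_div_iff₀ hμ]
  nlinarith

theorem exists_forall_Pobj_le {n p : ℕ} {f : (Fin n → ℝ) → ℝ} {Ω : Set (Fin p → ℝ)}
    (A : Matrix (Fin n) (Fin p) ℝ) (b : Fin n → ℝ) {μ ν : ℝ}
    (hf : Continuous f) (hfnn : ∀ z, 0 ≤ f z) (hΩne : Ω.Nonempty) (hΩcl : IsClosed Ω)
    (hμ : 0 < μ) (hν : 0 ≤ ν) :
    ∃ xs ∈ Ω, ∀ x ∈ Ω, Pobj f A b μ ν xs ≤ Pobj f A b μ ν x := by
  obtain ⟨x₀, hx₀⟩ := hΩne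
  have hbound := sum_sq_le_Pobj A b μ (ν := ν) hfnn hν
  have hx₀' : x₀ ∈ {x : Fin p → ℝ | μ / 2 * ∑ i, (x i) ^ 2 ≤ Pobj f A b μ ν x₀} ∩ Ω :=
    ⟨hbound x₀, hx₀⟩
  obtain ⟨xs, hxs, hmin⟩ :=
    ((lowerSemicontinuous_Pobj A b μ hf hν).lowerSemicontinuousOn _).exists_isMinOn
      ⟨x₀, hx₀'⟩
      ((isCompact_sum_sq_le hμ (Pobj f A b μ ν x₀)).inter_right hΩcl)
  refine ⟨xs, hxs.2, fun x hx => ?_⟩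
  by_cases hle : Pobj f A b μ ν x ≤ Pobj f A b μ ν x₀
  · exact hmin ⟨(hbound x).trans hle, hx⟩
  · exact (hmin hx₀').trans (not_le.mp hle).le

theorem MFeas.eq_one {p : ℕ} {Ω : Set (Fin p → ℝ)} {x w : Fin p → ℝ} (h : MFeas Ω x w)
    {i : Fin p} (hi : x i ≠ 0) : w i = 1 := by
  have h0 := (Finset.sum_eq_zero_iff_of_nonneg fun j _ =>
    mul_nonneg (sub_nonneg.mpr (h.2.1 j).2) (abs_nonneg (x j))).mp h.2.2 i (Finset.mem_univ i)
  rcases mul_eq_zero.mp h0 with h1 | h1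
  · linarith
  · exact absurd (abs_eq_zero.mp h1) hi

theorem MFeas.Pobj_le_Mobj {n p : ℕ} {f : (Fin n → ℝ) → ℝ} {Ω : Set (Fin p → ℝ)}
    {A : Matrix (Fin n) (Fin p) ℝ} {b : Fin n → ℝ} {μ ν : ℝ} {φ : ℝ → ℝ} {x w : Fin p → ℝ}
    (h : MFeas Ω x w) (hν : 0 ≤ ν) (hφ : ∀ t ∈ Set.Icc (0 : ℝ) 1, 0 ≤ φ t) (hφ1 : φ 1 = 1) :
    Pobj f A b μ ν x ≤ Mobj f A b μ ν φ x w := by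
  unfold Pobj Mobj
  rw [znorm_eq_sum]
  gcongr with i
  split_ifs with hi
  · rw [h.eq_one hi, hφ1]
  · exact hφ _ (h.2.1 i)

theorem mfeas_support {p : ℕ} {Ω : Set (Fin p → ℝ)} {x : Fin p → ℝ} (hx : x ∈ Ω) {t : ℝ}
    (ht : t ∈ Set.Icc (0 : ℝ) 1) : MFeas Ω x (fun i => if x i ≠ 0 then 1 else t) := by
  refine ⟨hx, fun i => ?_, Finset.sum_eq_zero fun i _ => ?_⟩
  · dsimp only
    split_ifs
    · simp
    · exact ht
  · by_cases hi : x i = 0 <;> simp [hi]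

theorem Mobj_support {n p : ℕ} (f : (Fin n → ℝ) → ℝ) (A : Matrix (Fin n) (Fin p) ℝ)
    (b : Fin n → ℝ) (μ ν : ℝ) {φ : ℝ → ℝ} {t : ℝ} (hφt : φ t = 0) (hφ1 : φ 1 = 1)
    (x : Fin p → ℝ) :
    Mobj f A b μ ν φ x (fun i => if x i ≠ 0 then 1 else t) = Pobj f A b μ ν x := by
  simp only [Mobj, Pobj, znorm_eq_sum, apply_ite φ, hφt, hφ1]

/-- equivalence of the zero-norm problem (P) and its MPEC reformulation (M). -/
theorem stmt1 {n p : ℕ} (f : (Fin n → ℝ) → ℝ) (Ω : Set (Fin p → ℝ))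
    (A : Matrix (Fin n) (Fin p) ℝ) (b : Fin n → ℝ) (μ ν : ℝ)
    (φ : ℝ → ℝ) (tstar : ℝ)
    (hf : Continuous f) (hfnn : ∀ z, 0 ≤ f z)
    (hΩne : Ω.Nonempty) (hΩcl : IsClosed Ω)
    (hμ : 0 < μ) (hν : 0 < ν)
    (hconv : ConvexOn ℝ (Set.Icc (0:ℝ) 1) φ)
    (htmem : tstar ∈ Set.Icc (0:ℝ) 1)
    (huniq : ∀ t ∈ Set.Icc (0:ℝ) 1, t ≠ tstar → φ tstar < φ t)
    (htlt : tstar < 1) (hφt : φ tstar = 0) (hφ1 : φ 1 = 1) :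
    -- (i) both problems attain their optimal values, and the optimal values coincide
    ((∃ xs ∈ Ω, (∀ x ∈ Ω, Pobj f A b μ ν xs ≤ Pobj f A b μ ν x) ∧
        ∃ x' w', MFeas Ω x' w' ∧
          (∀ x w, MFeas Ω x w → Mobj f A b μ ν φ x' w' ≤ Mobj f A b μ ν φ x w) ∧
          Mobj f A b μ ν φ x' w' = Pobj f A b μ ν xs) ∧
    -- (ii) a global minimizer (x*,w*) of (M) gives a global minimizer x* of (P)
    (∀ xs ws, MFeas Ω xs ws →
        (∀ x w, MFeas Ω x w → Mobj f A b μ ν φ xs ws ≤ Mobj f A b μ ν φ x w) →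
        xs ∈ Ω ∧ ∀ x ∈ Ω, Pobj f A b μ ν xs ≤ Pobj f A b μ ν x) ∧
    -- (iii) a global minimizer x* of (P) gives the global minimizer (x*, w*) of (M)
    (∀ xs ∈ Ω, (∀ x ∈ Ω, Pobj f A b μ ν xs ≤ Pobj f A b μ ν x) →
        (MFeas Ω xs (fun i => if xs i ≠ 0 then 1 else tstar) ∧
          ∀ x w, MFeas Ω x w →
            Mobj f A b μ ν φ xs (fun i => if xs i ≠ 0 then 1 else tstar) ≤
              Mobj f A b μ ν φ x w))) := by
  have hφ : ∀ t ∈ Set.Icc (0 : ℝ) 1, 0 ≤ φ t := by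
    intro t ht
    rcases eq_or_ne t tstar with rfl | hne
    · exact hφt.ge
    · exact hφt ▸ (huniq t ht hne).le
  have hle : ∀ x w, MFeas Ω x w → Pobj f A b μ ν x ≤ Mobj f A b μ ν φ x w :=
    fun x w h => h.Pobj_le_Mobj hν.le hφ hφ1
  have heq := Mobj_support f A b μ ν hφt hφ1
  have hlift : ∀ xs ∈ Ω, (∀ x ∈ Ω, Pobj f A b μ ν xs ≤ Pobj f A b μ ν x) →
      MFeas Ω xs (fun i => if xs i ≠ 0 then 1 else tstar) ∧
        ∀ x w, MFeas Ω x w →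
          Mobj f A b μ ν φ xs (fun i => if xs i ≠ 0 then 1 else tstar) ≤
            Mobj f A b μ ν φ x w :=
    fun xs hxs hmin => ⟨mfeas_support hxs htmem, fun x w h =>
      (heq xs).le.trans ((hmin x h.1).trans (hle x w h))⟩
  refine ⟨?_, fun xs ws hfeas hmin => ⟨hfeas.1, fun x hx => ?_⟩, hlift⟩
  · obtain ⟨xs, hxs, hmin⟩ := exists_forall_Pobj_le A b hf hfnn hΩne hΩcl hμ hν.le
    obtain ⟨hfeas, hM⟩ := hlift xs hxs hmin
    exact ⟨xs, hxs, hmin, xs, _, hfeas, hM, heq xs⟩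
  · exact (hle xs ws hfeas).trans ((hmin x _ (mfeas_support hx htmem)).trans (heq x).le)
end

section
/- Let f : ℝⁿ → ℝ be convex and nonnegative, Ω = {x ∈ ℝ^p : Bx ≤ c} a nonempty polyhedral set, A ∈ ℝ^{n×p}, b ∈ ℝⁿ, μ > 0, ν > 0, F_μ(x) = f(Ax−b) + (μ/2)‖x‖². Let φ : ℝ → ℝ be convex on an open interval containing [0,1], with a unique minimizer t* of φ over [0,1] satisfying t* < 1, φ(t*) = 0 and φ(1) = 1. Then there exists a threshold ρ̄ > 0 such that for every ρ ≥ ρ̄, the set of global minimizers over (x,w) ∈ Ω × [0,1]^p of the penalized objective F_μ(x) + ν[Σ_{i=1}^p φ(w_i) + ρ Σ_{i=1}^p (1−w_i)|x_i|] coincides with the set of global minimizers of the problem: minimize F_μ(x) + ν Σ_{i=1}^p φ(w_i) over (x,w) ∈ Ω × [0,1]^p subject to Σ_{i=1}^p (1−w_i)|x_i| = 0. -/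
open scoped BigOperators

/-- The penalized objective F_μ(x) + ν[∑ φ(wᵢ) + ρ ∑ (1-wᵢ)|xᵢ|]. -/
noncomputable def PenObj {n p : ℕ} (f : (Fin n → ℝ) → ℝ) (A : Matrix (Fin n) (Fin p) ℝ)
    (b : Fin n → ℝ) (μ ν : ℝ) (φ : ℝ → ℝ) (ρ : ℝ) (x w : Fin p → ℝ) : ℝ :=
  Fmu f A b μ x + ν * ((∑ i, φ (w i)) + ρ * ∑ i, (1 - w i) * |x i|)

/-- A set cut out by finitely many linear inequalities has finitely many extreme points. -/
theorem finite_extremePoints_of_linear_inequalities {E ι : Type*} [AddCommGroup E] [Module ℝ E]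
    [Finite ι] (a : ι → E →ₗ[ℝ] ℝ) (b : ι → ℝ) :
    ({x | ∀ i, a i x ≤ b i}.extremePoints ℝ).Finite := by
  refine Set.Finite.of_finite_image (f := fun x => {i | a i x = b i}) (Set.toFinite _) ?_
  intro x hx y hy hxy
  have hact : ∀ i, a i x = b i ↔ a i y = b i := fun i => Set.ext_iff.1 hxy i
  rw [mem_extremePoints] at hx hy
  have hev : ∀ᶠ ε in nhdsWithin (0:ℝ) (Set.Ioi 0), ∀ i, a i (x - ε • (y - x)) ≤ b i := by
    rw [Filter.eventually_all]
    intro i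
    by_cases hi : a i x = b i
    · refine Filter.Eventually.of_forall fun ε => ?_
      simp [hi, (hact i).1 hi]
    · have hlt : a i x < b i := lt_of_le_of_ne (hx.1 i) hi
      have hcont : Filter.Tendsto (fun ε : ℝ => a i x - ε * (a i y - a i x))
          (nhdsWithin 0 (Set.Ioi 0)) (nhds (a i x - 0 * (a i y - a i x))) :=
        (Continuous.tendsto (by fun_prop) 0).mono_left nhdsWithin_le_nhds
      filter_upwards [hcont.eventually_lt_const (by simpa using hlt)] with ε hε
      simpa using hε.le
  obtain ⟨ε, hε, hε0⟩ := (hev.and self_mem_nhdsWithin).exists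
  have hε0 : 0 < ε := hε0
  refine ((hx.2 _ hε _ hy.1 ⟨1 / (1 + ε), ε / (1 + ε), by positivity, by positivity,
    by field_simp, ?_⟩).2).symm
  have h1 : (1 + ε) ≠ 0 := by positivity
  match_scalars <;> field_simp <;> ring

/-- A compact set cut out by finitely many linear inequalities is the convex hull of a finite
set. -/
theorem exists_finite_convexHull_eq {E ι : Type*} [NormedAddCommGroup E] [NormedSpace ℝ E]
    [Finite ι] (a : ι → E →ₗ[ℝ] ℝ) (b : ι → ℝ) (hc : IsCompact {x | ∀ i, a i x ≤ b i}) :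
    ∃ V : Set E, V.Finite ∧ convexHull ℝ V = {x | ∀ i, a i x ≤ b i} := by
  have hfin := finite_extremePoints_of_linear_inequalities a b
  refine ⟨_, hfin, ?_⟩
  have hconv : Convex ℝ {x | ∀ i, a i x ≤ b i} := by
    rw [Set.ofPred_forall]
    exact convex_iInter fun i => convex_halfSpace_le (a i).isLinear (b i)
  conv_rhs => rw [← closure_convexHull_extremePoints hc hconv]
  exact (hfin.isClosed_convexHull ℝ).closure_eq.symm

/-- Error bound on a polytope: a linear functional that is nonnegative on it either dominates the
distance to its zero set in the polytope, or is bounded away from zero. -/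
theorem convexHull_error_bound {E : Type*} [NormedAddCommGroup E] [NormedSpace ℝ E]
    {V : Set E} (hV : V.Finite) (g : E →ₗ[ℝ] ℝ) (hg : ∀ v ∈ V, 0 ≤ g v) :
    ∃ κ > (0:ℝ), ∀ x ∈ convexHull ℝ V,
      (∃ y ∈ convexHull ℝ V, g y = 0 ∧ ‖x - y‖ ≤ κ * g x) ∨ 1 ≤ κ * g x := by
  set V₀ := {v ∈ V | g v = 0}
  set V₁ := {v ∈ V | 0 < g v}
  have hVu : V = V₀ ∪ V₁ := by
    ext v
    constructor
    · intro hv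
      rcases (hg v hv).eq_or_lt with h | h
      · exact Or.inl ⟨hv, h.symm⟩
      · exact Or.inr ⟨hv, h⟩
    · rintro (h | h) <;> exact h.1
  have hV₁f : V₁.Finite := hV.subset fun v hv => hv.1
  obtain ⟨δ, hδ, hδV⟩ : ∃ δ > (0:ℝ), ∀ v ∈ V₁, δ ≤ g v := by
    rcases V₁.eq_empty_or_nonempty with h | h
    · exact ⟨1, one_pos, by simp [h]⟩
    · obtain ⟨v, hv, hmin⟩ := Set.exists_min_image V₁ g hV₁f h
      exact ⟨g v, hv.2, hmin⟩
  have hconv₁ : ∀ v ∈ convexHull ℝ V₁, δ ≤ g v := fun v hv =>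
    convexHull_min (s := V₁) hδV (convex_halfSpace_ge g.isLinear δ) hv
  have hconv₀ : ∀ v ∈ convexHull ℝ V₀, g v = 0 := fun v hv =>
    convexHull_min (s := V₀) (fun u hu => hu.2) (convex_hyperplane g.isLinear 0) hv
  have hbdd : Bornology.IsBounded (convexHull ℝ V) := isBounded_convexHull.2 hV.isBounded
  obtain ⟨D, hD⟩ := hbdd.exists_norm_le
  refine ⟨(2 * |D| + 1) / δ, by positivity, fun x hx => ?_⟩
  rcases V₀.eq_empty_or_nonempty with h₀ | h₀
  · right
    rw [hVu, h₀, Set.empty_union] at hx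
    have := hconv₁ x hx
    calc (1:ℝ) ≤ 2 * |D| + 1 := by linarith [abs_nonneg D]
      _ = (2 * |D| + 1) / δ * δ := by field_simp
      _ ≤ _ := by gcongr
  left
  rcases V₁.eq_empty_or_nonempty with h₁ | h₁
  · have hx' := hx
    rw [hVu, h₁, Set.union_empty] at hx'
    exact ⟨x, hx, hconv₀ x hx', by simp [hconv₀ x hx']⟩
  have hx' := hx
  rw [hVu, convexHull_union h₀ h₁, mem_convexJoin] at hx'
  obtain ⟨u, hu, v, hv, α, β, hα, hβ, hαβ, rfl⟩ := hx'
  have huV : u ∈ convexHull ℝ V := convexHull_mono (fun w hw => hw.1) hu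
  have hvV : v ∈ convexHull ℝ V := convexHull_mono (fun w hw => hw.1) hv
  refine ⟨u, huV, hconv₀ u hu, ?_⟩
  have hdiff : α • u + β • v - u = β • (v - u) := by
    obtain rfl : α = 1 - β := by linarith
    module
  have hvu : ‖v - u‖ ≤ 2 * |D| + 1 := by
    have := norm_sub_le v u
    linarith [hD v hvV, hD u huV, le_abs_self D]
  rw [hdiff, norm_smul, Real.norm_of_nonneg hβ, map_add, map_smul, map_smul, hconv₀ u hu]
  simp only [smul_eq_mul, mul_zero, zero_add]
  calc β * ‖v - u‖ ≤ β * (2 * |D| + 1) := by gcongr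
    _ = (2 * |D| + 1) / δ * (β * δ) := by field_simp
    _ ≤ _ := by gcongr; exact hconv₁ v hv

/-- Error bound for the vanishing of the coordinates in `I` on a polyhedron intersected with a
box. -/
theorem coordinate_error_bound {p m : ℕ} (B : Matrix (Fin m) (Fin p) ℝ) (c : Fin m → ℝ) (R : ℝ)
    (I : Finset (Fin p)) :
    ∃ κ > (0:ℝ), ∀ x : Fin p → ℝ, (∀ j, B.mulVec x j ≤ c j) → (∀ i, |x i| ≤ R) →
      (∃ y : Fin p → ℝ, (∀ j, B.mulVec y j ≤ c j) ∧ (∀ i, |y i| ≤ R) ∧ (∀ i ∈ I, y i = 0) ∧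
        ‖x - y‖ ≤ κ * ∑ i ∈ I, |x i|) ∨ 1 ≤ κ * ∑ i ∈ I, |x i| := by
  let X : Fin p → ((Fin p → ℝ) × (Fin p → ℝ)) →ₗ[ℝ] ℝ :=
    fun i => LinearMap.proj i ∘ₗ LinearMap.fst ℝ _ _
  let S : Fin p → ((Fin p → ℝ) × (Fin p → ℝ)) →ₗ[ℝ] ℝ :=
    fun i => LinearMap.proj i ∘ₗ LinearMap.snd ℝ _ _
  let a : Fin m ⊕ Fin p ⊕ Fin p ⊕ Fin p → ((Fin p → ℝ) × (Fin p → ℝ)) →ₗ[ℝ] ℝ :=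
    Sum.elim (fun j => LinearMap.proj j ∘ₗ B.mulVecLin ∘ₗ LinearMap.fst ℝ _ _)
      (Sum.elim (fun i => X i - S i) (Sum.elim (fun i => -X i - S i) S))
  let b : Fin m ⊕ Fin p ⊕ Fin p ⊕ Fin p → ℝ :=
    Sum.elim c (Sum.elim 0 (Sum.elim 0 fun _ => R))
  have hP : ∀ z : (Fin p → ℝ) × (Fin p → ℝ), (∀ k, a k z ≤ b k) ↔
      (∀ j, B.mulVec z.1 j ≤ c j) ∧ (∀ i, |z.1 i| ≤ z.2 i) ∧ ∀ i, z.2 i ≤ R := by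
    intro z
    simp only [Sum.forall, a, b, X, S, Sum.elim_inl, Sum.elim_inr, LinearMap.sub_apply,
      LinearMap.neg_apply, LinearMap.comp_apply, LinearMap.fst_apply, LinearMap.snd_apply,
      LinearMap.proj_apply, Matrix.mulVecLin_apply, Pi.zero_apply, abs_le]
    refine and_congr_right fun _ => ⟨fun ⟨h1, h2, h3⟩ => ⟨fun i => ⟨?_, ?_⟩, h3⟩,
      fun ⟨h1, h2⟩ => ⟨fun i => ?_, fun i => ?_, h2⟩⟩
    · linarith [h2 i]
    · linarith [h1 i]
    · linarith [(h1 i).2]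
    · linarith [(h1 i).1]
  have hcomp : IsCompact {z : (Fin p → ℝ) × (Fin p → ℝ) | ∀ k, a k z ≤ b k} := by
    refine (isCompact_Icc (a := ((fun _ => -R, fun _ => -R) : (Fin p → ℝ) × (Fin p → ℝ)))
      (b := (fun _ => R, fun _ => R))).of_isClosed_subset ?_ ?_
    · rw [Set.ofPred_forall]
      exact isClosed_iInter fun k =>
        isClosed_le (LinearMap.continuous_of_finiteDimensional (a k)) continuous_const
    · intro z hz
      obtain ⟨-, h1, h2⟩ := (hP z).1 hz
      refine ⟨⟨fun i => ?_, fun i => ?_⟩, ⟨fun i => ?_, fun i => h2 i⟩⟩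
      · exact neg_le_of_abs_le ((h1 i).trans (h2 i))
      · change -R ≤ z.2 i
        linarith [abs_nonneg (z.1 i), h1 i, h2 i]
      · exact le_of_abs_le ((h1 i).trans (h2 i))
  obtain ⟨V, hV, hVP⟩ := exists_finite_convexHull_eq a b hcomp
  have hg : ∀ z : (Fin p → ℝ) × (Fin p → ℝ), (∑ i ∈ I, S i) z = ∑ i ∈ I, z.2 i :=
    fun z => by simp [S]
  obtain ⟨κ, hκ, h⟩ := convexHull_error_bound hV (∑ i ∈ I, S i) fun v hv => by
    have hv' : v ∈ {z : (Fin p → ℝ) × (Fin p → ℝ) | ∀ k, a k z ≤ b k} :=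
      hVP ▸ subset_convexHull ℝ V hv
    rw [hg]
    exact Finset.sum_nonneg fun i _ => (abs_nonneg _).trans (((hP v).1 hv').2.1 i)
  rw [hVP] at h
  refine ⟨κ, hκ, fun x hxB hxR => ?_⟩
  have hx := h (x, fun i => |x i|) ((hP _).2 ⟨hxB, fun i => le_rfl, hxR⟩)
  rw [hg] at hx
  refine hx.imp_left ?_
  rintro ⟨y, hy, hy0, hxy⟩
  obtain ⟨h1, h2, h3⟩ := (hP y).1 hy
  refine ⟨y.1, h1, fun i => (h2 i).trans (h3 i), fun i hi => ?_, (norm_fst_le _).trans hxy⟩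
  rw [hg, Finset.sum_eq_zero_iff_of_nonneg fun i _ => (abs_nonneg _).trans (h2 i)] at hy0
  exact abs_nonpos_iff.1 ((h2 i).trans (hy0 i hi).le)

/-- The objective `Fmu` is Lipschitz on boxes. -/
theorem Fmu_lipschitz_on_box {n p : ℕ} {f : (Fin n → ℝ) → ℝ} (hf : ConvexOn ℝ Set.univ f)
    (A : Matrix (Fin n) (Fin p) ℝ) (b : Fin n → ℝ) {μ : ℝ} (hμ : 0 ≤ μ) (R : ℝ) :
    ∃ L ≥ (0:ℝ), ∀ x y : Fin p → ℝ, (∀ i, |x i| ≤ R) → (∀ i, |y i| ≤ R) →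
      Fmu f A b μ y ≤ Fmu f A b μ x + L * ‖x - y‖ := by
  have hsq : ConvexOn ℝ Set.univ fun x : Fin p → ℝ => ∑ i, (x i) ^ 2 := by
    refine ⟨convex_univ, fun x _ y _ s t hs ht hst => ?_⟩
    simp only [smul_eq_mul, Finset.mul_sum, ← Finset.sum_add_distrib]
    exact Finset.sum_le_sum fun i _ =>
      (even_two.convexOn_pow (𝕜 := ℝ)).2 (Set.mem_univ (x i)) (Set.mem_univ (y i)) hs ht hst
  have hconv : ConvexOn ℝ Set.univ (Fmu f A b μ) := by
    have h1 : ConvexOn ℝ Set.univ fun x : Fin p → ℝ => f (A.mulVec x - b) := by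
      have h := hf.comp_affineMap (A.mulVecLin.toAffineMap - AffineMap.const ℝ _ b)
      rwa [Set.preimage_univ] at h
    exact h1.add (hsq.smul (by positivity : 0 ≤ μ / 2))
  obtain ⟨K, hK⟩ := (hconv.locallyLipschitz.locallyLipschitzOn
    (s := Set.Icc (fun _ => -R) (fun _ => R))).exists_lipschitzOnWith_of_compact isCompact_Icc
  refine ⟨K, K.2, fun x y hx hy => ?_⟩
  have hmem : ∀ z : Fin p → ℝ, (∀ i, |z i| ≤ R) → z ∈ Set.Icc (fun _ => -R) (fun _ => R) :=
    fun z hz => ⟨fun i => (abs_le.1 (hz i)).1, fun i => (abs_le.1 (hz i)).2⟩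
  have h := hK.dist_le_mul y (hmem y hy) x (hmem x hx)
  rw [dist_comm y x, dist_eq_norm x y, Real.dist_eq] at h
  linarith [le_abs_self (Fmu f A b μ y - Fmu f A b μ x)]

/-- A function convex on a neighbourhood of `[0,1]` lies above a line through `(1, φ 1)`. -/
theorem exists_slope_lower_bound {φ : ℝ → ℝ}
    (hconv : ∃ U : Set ℝ, IsOpen U ∧ Set.Icc (0:ℝ) 1 ⊆ U ∧ ConvexOn ℝ U φ) :
    ∃ M > (0:ℝ), ∀ t ∈ Set.Icc (0:ℝ) 1, φ 1 - M * (1 - t) ≤ φ t := by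
  obtain ⟨U, hU, hIU, hφ⟩ := hconv
  have h1 : (1:ℝ) ∈ U := hIU ⟨zero_le_one, le_rfl⟩
  obtain ⟨r, hr, hrU⟩ := Metric.isOpen_iff.1 hU 1 h1
  have hz : 1 + r / 2 ∈ U := hrU (by simp [abs_of_pos hr, hr])
  refine ⟨max 1 ((φ (1 + r / 2) - φ 1) / (1 + r / 2 - 1)), by positivity, fun t ht => ?_⟩
  rcases ht.2.eq_or_lt with rfl | hlt
  · simp
  have hs := (hφ.slope_mono_adjacent (hIU ht) hz hlt (by linarith)).trans (le_max_right 1 _)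
  rw [div_le_iff₀ (by linarith)] at hs
  linarith

/-- The penalized cost `φ t + s (1 - t)` of a coordinate `t ∈ [0,1]` dominates `s / M` when
`s ≤ M`. -/
theorem penalty_lower_bound_of_le {M s t u : ℝ} (hM : 0 < M) (hs : 0 ≤ s) (hsM : s ≤ M)
    (hu : 0 ≤ u) (hut : 1 - M * (1 - t) ≤ u) : s / M ≤ u + s * (1 - t) := by
  rw [div_le_iff₀ hM]
  nlinarith [mul_le_mul_of_nonneg_left hut hs, mul_nonneg (sub_nonneg.2 hsM) hu]

/-- Once `ρ` is large, every infeasible point of moderate penalized objective is strictly beaten by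
a feasible one. -/
theorem exists_feasible_lt_PenObj {n p m : ℕ} {f : (Fin n → ℝ) → ℝ}
    (B : Matrix (Fin m) (Fin p) ℝ) (c : Fin m → ℝ) (A : Matrix (Fin n) (Fin p) ℝ)
    (b : Fin n → ℝ) {μ ν : ℝ} {φ : ℝ → ℝ} {tstar : ℝ} (hf : ConvexOn ℝ Set.univ f)
    (hfnn : ∀ z, 0 ≤ f z) (hμ : 0 < μ) (hν : 0 < ν)
    (hconv : ∃ U : Set ℝ, IsOpen U ∧ Set.Icc (0:ℝ) 1 ⊆ U ∧ ConvexOn ℝ U φ)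
    (htmem : tstar ∈ Set.Icc (0:ℝ) 1) (hφnn : ∀ t ∈ Set.Icc (0:ℝ) 1, 0 ≤ φ t)
    (hφt : φ tstar = 0) (hφ1 : φ 1 = 1) (C : ℝ) :
    ∃ ρbar > (0:ℝ), ∀ ρ : ℝ, ρbar ≤ ρ → ∀ x w : Fin p → ℝ, (∀ j, B.mulVec x j ≤ c j) →
      (∀ i, w i ∈ Set.Icc (0:ℝ) 1) → (∑ i, (1 - w i) * |x i|) ≠ 0 →
      PenObj f A b μ ν φ ρ x w ≤ C →
      ∃ y v : Fin p → ℝ, (∀ j, B.mulVec y j ≤ c j) ∧ (∀ i, v i ∈ Set.Icc (0:ℝ) 1) ∧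
        (∑ i, (1 - v i) * |y i|) = 0 ∧
        Fmu f A b μ y + ν * ∑ i, φ (v i) < PenObj f A b μ ν φ ρ x w := by
  obtain ⟨M, hM, hMφ⟩ := exists_slope_lower_bound hconv
  rw [hφ1] at hMφ
  set R := √(2 * C / μ)
  obtain ⟨L, hL, hLip⟩ := Fmu_lipschitz_on_box hf A b hμ.le R
  choose κI hκI hEB using coordinate_error_bound B c R
  set κ := ∑ I, κI I
  have hκle : ∀ I, κI I ≤ κ := fun I =>
    Finset.single_le_sum (fun J _ => (hκI J).le) (Finset.mem_univ I)
  have hκ : 0 < κ := (hκI ∅).trans_le (hκle ∅)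
  refine ⟨(L * κ / ν + κ * p + 1) * M, by positivity, fun ρ hρ x w hx hw hinf hC => ?_⟩
  have hρ0 : 0 < ρ := lt_of_lt_of_le (by positivity) hρ
  have hterm : ∀ i, 0 ≤ (1 - w i) * |x i| := fun i =>
    mul_nonneg (sub_nonneg.2 (hw i).2) (abs_nonneg _)
  have hxR : ∀ i, |x i| ≤ R := by
    intro i
    apply Real.abs_le_sqrt
    rw [le_div_iff₀ hμ]
    have h1 : 0 ≤ ν * ((∑ i, φ (w i)) + ρ * ∑ i, (1 - w i) * |x i|) :=
      mul_nonneg hν.le (add_nonneg (Finset.sum_nonneg fun i _ => hφnn _ (hw i))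
        (mul_nonneg hρ0.le (Finset.sum_nonneg fun i _ => hterm i)))
    have h2 : x i ^ 2 ≤ ∑ j, x j ^ 2 :=
      Finset.single_le_sum (f := fun j => x j ^ 2) (fun j _ => sq_nonneg _) (Finset.mem_univ i)
    have h3 := hfnn (A.mulVec x - b)
    unfold PenObj Fmu at hC
    nlinarith [mul_le_mul_of_nonneg_left h2 hμ.le]
  set I : Finset (Fin p) := {i | ρ * |x i| ≤ M} with hI
  set S := ∑ i ∈ I, |x i| with hS
  have hS0 : 0 ≤ S := Finset.sum_nonneg fun i _ => abs_nonneg _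
  have hSle : ρ * S ≤ p * M := by
    rw [hS, Finset.mul_sum]
    calc ∑ i ∈ I, ρ * |x i| ≤ ∑ i ∈ I, M := Finset.sum_le_sum fun i hi => by simpa [hI] using hi
      _ = I.card * M := by simp
      _ ≤ p * M := by
        gcongr
        simpa using Finset.card_le_univ I
  have hκS : κI I * S < 1 := by
    have h1 : κ * (ρ * S) ≤ κ * (p * M) := by gcongr
    have h2 : κ * p * M < ρ := lt_of_lt_of_le (by
      have : 0 ≤ L * κ / ν * M := by positivity
      nlinarith) hρ
    have h3 : κ * S < 1 := by
      by_contra! h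
      nlinarith [mul_le_mul_of_nonneg_left h hρ0.le]
    exact (mul_le_mul_of_nonneg_right (hκle I) hS0).trans_lt h3
  obtain ⟨y, hyB, hyR, hyI, hxy⟩ := (hEB I x hx hxR).resolve_right (not_le.2 hκS)
  set v : Fin p → ℝ := fun i => if i ∈ I then tstar else 1 with hv
  have hFy : Fmu f A b μ y ≤ Fmu f A b μ x + L * κ * S := by
    have h1 : ‖x - y‖ ≤ κ * S := hxy.trans (mul_le_mul_of_nonneg_right (hκle I) hS0)
    have h2 := mul_le_mul_of_nonneg_left h1 hL
    linarith [hLip x y hxR hyR]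
  have hcoord : ∀ i, φ (v i) + (if i ∈ I then ρ * |x i| / M else 0)
      ≤ φ (w i) + ρ * ((1 - w i) * |x i|) := by
    intro i
    by_cases hi : i ∈ I
    · have hle : ρ * |x i| ≤ M := by simpa [hI] using hi
      have := penalty_lower_bound_of_le hM (by positivity) hle (hφnn _ (hw i)) (hMφ _ (hw i))
      simp only [hv, hi, if_true, hφt]
      linarith
    · have hlt : M < ρ * |x i| := by simpa [hI] using hi
      simp only [hv, hi, if_false, hφ1]
      nlinarith [hMφ _ (hw i), mul_le_mul_of_nonneg_left hlt.le (sub_nonneg.2 (hw i).2)]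
  have hsumv : ∑ i, (φ (v i) + if i ∈ I then ρ * |x i| / M else 0)
      = ∑ i, φ (v i) + ρ / M * S := by
    rw [Finset.sum_add_distrib, Finset.sum_ite_mem, Finset.univ_inter, hS, Finset.mul_sum]
    congr 1
    exact Finset.sum_congr rfl fun i _ => by ring
  have hsumw : ∑ i, (φ (w i) + ρ * ((1 - w i) * |x i|))
      = ∑ i, φ (w i) + ρ * ∑ i, (1 - w i) * |x i| := by
    rw [Finset.sum_add_distrib, Finset.mul_sum]
  refine ⟨y, v, hyB, fun i => ?_, Finset.sum_eq_zero fun i _ => ?_, ?_⟩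
  · by_cases hi : i ∈ I
    · simpa [hv, hi] using htmem
    · simp [hv, hi]
  · by_cases hi : i ∈ I
    · simp [hyI i hi]
    · simp [hv, hi]
  unfold PenObj
  rw [← hsumw]
  rcases hS0.eq_or_lt with hSz | hSpos
  · rw [← hSz, mul_zero, add_zero] at hsumv
    rw [← hSz, mul_zero, add_zero] at hFy
    have hlt : ∑ i, φ (v i) < ∑ i, (φ (w i) + ρ * ((1 - w i) * |x i|)) := by
      rw [← hsumv]
      refine Finset.sum_lt_sum (fun i _ => hcoord i) ?_
      obtain ⟨i, -, hi⟩ := Finset.exists_ne_zero_of_sum_ne_zero hinf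
      have hiI : i ∉ I := fun h => hi (by
        rw [(Finset.sum_eq_zero_iff_of_nonneg fun i _ => abs_nonneg (x i)).1 hSz.symm i h,
          mul_zero])
      have hw1 : 0 < 1 - w i :=
        (sub_nonneg.2 (hw i).2).lt_of_ne fun h => hi (by rw [← h, zero_mul])
      have hlt : M < ρ * |x i| := by simpa [hI] using hiI
      refine ⟨i, Finset.mem_univ i, ?_⟩
      simp only [hv, hiI, if_false, hφ1]
      nlinarith [hMφ _ (hw i), mul_lt_mul_of_pos_left hlt hw1]
    linarith [mul_lt_mul_of_pos_left hlt hν]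
  · have hle := Finset.sum_le_sum fun i (_ : i ∈ Finset.univ) => hcoord i
    rw [hsumv] at hle
    have hgap : L * κ < ν * (ρ / M) := by
      have h1 : L * κ / ν < ρ / M := by
        rw [lt_div_iff₀ hM]
        refine lt_of_lt_of_le ?_ hρ
        gcongr
        nlinarith [mul_nonneg hκ.le (Nat.cast_nonneg (α := ℝ) p)]
      rwa [div_lt_iff₀' hν] at h1
    nlinarith [mul_lt_mul_of_pos_right hgap hSpos, mul_le_mul_of_nonneg_left hle hν.le]

/-- global exact penalization of the MPEC reformulation. -/
theorem stmt3 {n p m : ℕ} (f : (Fin n → ℝ) → ℝ)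
    (B : Matrix (Fin m) (Fin p) ℝ) (c : Fin m → ℝ)
    (A : Matrix (Fin n) (Fin p) ℝ) (b : Fin n → ℝ) (μ ν : ℝ)
    (φ : ℝ → ℝ) (tstar : ℝ)
    (hfconv : ConvexOn ℝ Set.univ f) (hfnn : ∀ z, 0 ≤ f z)
    (Ω : Set (Fin p → ℝ)) (hΩ : Ω = {x | ∀ j, B.mulVec x j ≤ c j})
    (hΩne : Ω.Nonempty)
    (hμ : 0 < μ) (hν : 0 < ν)
    (hconv : ∃ U : Set ℝ, IsOpen U ∧ Set.Icc (0:ℝ) 1 ⊆ U ∧ ConvexOn ℝ U φ)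
    (htmem : tstar ∈ Set.Icc (0:ℝ) 1)
    (huniq : ∀ t ∈ Set.Icc (0:ℝ) 1, t ≠ tstar → φ tstar < φ t)
    (htlt : tstar < 1) (hφt : φ tstar = 0) (hφ1 : φ 1 = 1) :
    ∃ ρbar > (0:ℝ), ∀ ρ : ℝ, ρbar ≤ ρ →
      {xw : (Fin p → ℝ) × (Fin p → ℝ) |
          xw.1 ∈ Ω ∧ (∀ i, xw.2 i ∈ Set.Icc (0:ℝ) 1) ∧
          ∀ x w : Fin p → ℝ, x ∈ Ω → (∀ i, w i ∈ Set.Icc (0:ℝ) 1) →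
            PenObj f A b μ ν φ ρ xw.1 xw.2 ≤ PenObj f A b μ ν φ ρ x w} =
      {xw : (Fin p → ℝ) × (Fin p → ℝ) |
          xw.1 ∈ Ω ∧ (∀ i, xw.2 i ∈ Set.Icc (0:ℝ) 1) ∧
          (∑ i, (1 - xw.2 i) * |xw.1 i|) = 0 ∧
          ∀ x w : Fin p → ℝ, x ∈ Ω → (∀ i, w i ∈ Set.Icc (0:ℝ) 1) →
            (∑ i, (1 - w i) * |x i|) = 0 →
            (Fmu f A b μ xw.1 + ν * ∑ i, φ (xw.2 i)) ≤
              (Fmu f A b μ x + ν * ∑ i, φ (w i))} := by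
  subst hΩ
  obtain ⟨x₀, hx₀⟩ := hΩne
  have hφnn : ∀ t ∈ Set.Icc (0:ℝ) 1, 0 ≤ φ t := fun t ht => by
    rcases eq_or_ne t tstar with rfl | h
    · exact hφt.ge
    · exact hφt ▸ (huniq t ht h).le
  have hpen : ∀ ρ (x w : Fin p → ℝ), (∑ i, (1 - w i) * |x i|) = 0 →
      PenObj f A b μ ν φ ρ x w = Fmu f A b μ x + ν * ∑ i, φ (w i) := fun ρ x w h => by
    rw [PenObj, h, mul_zero, add_zero]
  have hone : (∑ i, (1 - (1 : Fin p → ℝ) i) * |x₀ i|) = 0 := by simp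
  have honemem : ∀ i, (1 : Fin p → ℝ) i ∈ Set.Icc (0:ℝ) 1 := fun i => by simp
  obtain ⟨ρbar, hρbar, hbeat⟩ := exists_feasible_lt_PenObj B c A b hfconv hfnn hμ hν hconv htmem
    hφnn hφt hφ1 (Fmu f A b μ x₀ + ν * ∑ i, φ ((1 : Fin p → ℝ) i))
  refine ⟨ρbar, hρbar, fun ρ hρ => Set.ext fun ⟨x, w⟩ => ⟨?_, ?_⟩⟩
  · rintro ⟨hx, hw, hmin⟩
    have hfeas : (∑ i, (1 - w i) * |x i|) = 0 := by
      by_contra hne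
      obtain ⟨y, v, hy, hv, hyv, hlt⟩ := hbeat ρ hρ x w hx hw hne
        ((hmin x₀ 1 hx₀ honemem).trans_eq (hpen ρ x₀ 1 hone))
      exact hlt.not_ge ((hmin y v hy hv).trans_eq (hpen ρ y v hyv))
    refine ⟨hx, hw, hfeas, fun y v hy hv hyv => ?_⟩
    rw [← hpen ρ x w hfeas, ← hpen ρ y v hyv]
    exact hmin y v hy hv
  · rintro ⟨hx, hw, hfeas, hmin⟩
    refine ⟨hx, hw, fun y v hy hv => ?_⟩
    refine (hpen ρ x w hfeas).trans_le ?_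
    by_cases hyv : (∑ i, (1 - v i) * |y i|) = 0
    · exact (hmin y v hy hv hyv).trans_eq (hpen ρ y v hyv).symm
    rcases le_total (PenObj f A b μ ν φ ρ y v)
      (Fmu f A b μ x₀ + ν * ∑ i, φ ((1 : Fin p → ℝ) i)) with hC | hC
    · obtain ⟨y', v', hy', hv', hyv', hlt⟩ := hbeat ρ hρ y v hy hv hyv hC
      exact (hmin y' v' hy' hv' hyv').trans hlt.le
    · exact (hmin x₀ 1 hx₀ honemem hone).trans hC
end

section
/- Let a > 1 and ρ > 0. The function g_ρ : ℝ^p → ℝ, g_ρ(x) = ρ⁻¹ Σ_{i=1}^p ψ*_a(ρ|x_i|), is differentiable on all of ℝ^p, and its gradient is given componentwise by ∂g_ρ(x)/∂x_i = w_ρ(x)_i · sign(x_i), where sign(0) = 0; equivalently, for each t ∈ ℝ the scalar function t ↦ ρ⁻¹ψ*_a(ρ|t|) is differentiable with derivative 0 if |t| ≤ 2/(ρ(a+1)), (((a+1)ρ|t|−2)/(2(a−1)))·sign(t) if 2/(ρ(a+1)) < |t| ≤ 2a/(ρ(a+1)), and sign(t) if |t| > 2a/(ρ(a+1)). -/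
open scoped BigOperators

/-- The piecewise function ψ*_a. -/
noncomputable def psiStar (a s : ℝ) : ℝ :=
  if s ≤ 2 / (a + 1) then 0
  else if s ≤ 2 * a / (a + 1) then ((a + 1) * s - 2) ^ 2 / (4 * (a ^ 2 - 1))
  else s - 1

/-- g_ρ(x) = ρ⁻¹ ∑ᵢ ψ*_a(ρ|xᵢ|). -/
noncomputable def gRho {p : ℕ} (a ρ : ℝ) (x : Fin p → ℝ) : ℝ :=
  ρ⁻¹ * ∑ i, psiStar a (ρ * |x i|)

/-- w_ρ(x)ᵢ = min(1, max(0, ((a+1)ρ|xᵢ| − 2)/(2(a−1)))). -/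
noncomputable def wRho {p : ℕ} (a ρ : ℝ) (x : Fin p → ℝ) : Fin p → ℝ :=
  fun i => min 1 (max 0 (((a + 1) * ρ * |x i| - 2) / (2 * (a - 1))))

/-- The piecewise derivative of t ↦ ρ⁻¹ψ*_a(ρ|t|). -/
noncomputable def dVarphi (a ρ t : ℝ) : ℝ :=
  if |t| ≤ 2 / (ρ * (a + 1)) then 0
  else if |t| ≤ 2 * a / (ρ * (a + 1)) then
    ((a + 1) * ρ * |t| - 2) / (2 * (a - 1)) * Real.sign t
  else Real.sign t

/-- The square of the positive part is differentiable, with derivative twice the positive part. -/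
theorem hasDerivAt_max_zero_sq (x : ℝ) :
    HasDerivAt (fun y : ℝ => max 0 y ^ 2) (2 * max 0 x) x := by
  have hO : (fun y : ℝ => max 0 y ^ 2 - max 0 x ^ 2 - 2 * max 0 x * (y - x))
      =O[nhds x] fun y => ‖y - x‖ ^ 2 := by
    refine Asymptotics.IsBigO.of_bound 1 (Filter.Eventually.of_forall fun y => ?_)
    rw [Real.norm_eq_abs, norm_pow, Real.norm_eq_abs, Real.norm_eq_abs, abs_abs, sq_abs, abs_le]
    rcases max_cases 0 x with ⟨h, h'⟩ | ⟨h, h'⟩ <;> rcases max_cases 0 y with ⟨k, k'⟩ | ⟨k, k'⟩ <;>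
      rw [h, k] <;> constructor <;> nlinarith
  have h := (hO.hasFDerivAt one_lt_two).hasDerivAt.add
    ((((hasDerivAt_id x).sub_const x).const_mul (2 * max 0 x)).add_const (max 0 x ^ 2))
  refine (h.congr_deriv (by simp)).congr_of_eventuallyEq (Filter.Eventually.of_forall fun y => ?_)
  simp only [Pi.add_apply, id]
  ring

theorem psiStar_eq_max_sq_sub {a : ℝ} (ha : 1 < a) (s : ℝ) :
    psiStar a s = (max 0 ((a + 1) * s - 2) ^ 2 - max 0 ((a + 1) * s - 2 * a) ^ 2) /
      (4 * (a ^ 2 - 1)) := by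
  have h1 : 0 < a + 1 := by linarith
  have h2 : a ^ 2 - 1 ≠ 0 := by nlinarith
  unfold psiStar
  simp only [le_div_iff₀ h1]
  split_ifs with h h'
  · rw [max_eq_left (by linarith), max_eq_left (by linarith)]; simp
  · rw [max_eq_right (by linarith), max_eq_left (by linarith)]; simp
  · rw [max_eq_right (by linarith), max_eq_right (by linarith)]
    field_simp
    ring

theorem hasDerivAt_psiStar {a : ℝ} (ha : 1 < a) (s : ℝ) :
    HasDerivAt (psiStar a) (min 1 (max 0 (((a + 1) * s - 2) / (2 * (a - 1))))) s := by
  have h1 : 0 < a + 1 := by linarith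
  have h2 : 0 < a - 1 := by linarith
  have h3 : a ^ 2 - 1 = (a - 1) * (a + 1) := by ring
  have hlin (c : ℝ) : HasDerivAt (fun s => (a + 1) * s - c) (a + 1) s := by
    simpa using ((hasDerivAt_id s).const_mul (a + 1)).sub_const c
  have h := (((hasDerivAt_max_zero_sq _).comp s (hlin 2)).sub
    ((hasDerivAt_max_zero_sq _).comp s (hlin (2 * a)))).div_const (4 * (a ^ 2 - 1))
  rw [funext (psiStar_eq_max_sq_sub ha)]
  refine h.congr_deriv ?_
  rw [h3]
  rcases le_total ((a + 1) * s) 2 with k | k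
  · rw [max_eq_left (div_nonpos_of_nonpos_of_nonneg (by linarith) (by linarith)),
      max_eq_left (by linarith), max_eq_left (by linarith)]
    simp
  rw [max_eq_right (div_nonneg (by linarith) (by linarith)), max_eq_right (by linarith)]
  rcases le_total ((a + 1) * s) (2 * a) with l | l
  · rw [min_eq_right ((div_le_one (by linarith)).2 (by linarith)), max_eq_left (by linarith)]
    field_simp
    ring
  · rw [min_eq_left ((one_le_div (by linarith)).2 (by linarith)), max_eq_right (by linarith)]
    field_simp
    ring

theorem hasDerivAt_psiStar_abs {a ρ : ℝ} (ha : 1 < a) (hρ : 0 < ρ) (t : ℝ) :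
    HasDerivAt (fun s => ρ⁻¹ * psiStar a (ρ * |s|))
      (min 1 (max 0 (((a + 1) * ρ * |t| - 2) / (2 * (a - 1)))) * Real.sign t) t := by
  rcases eq_or_ne t 0 with rfl | ht
  · rw [Real.sign_zero, mul_zero]
    refine (hasDerivAt_const (0 : ℝ) (0 : ℝ)).congr_of_eventuallyEq ?_
    have hc : ContinuousAt (fun s : ℝ => ρ * |s|) 0 := by fun_prop
    have hpos : ρ * |(0 : ℝ)| < 2 / (a + 1) := by
      rw [abs_zero, mul_zero]
      exact div_pos two_pos (by linarith)
    filter_upwards [hc.eventually_lt continuousAt_const hpos] with s hs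
    simp [psiStar, hs.le]
  · have habs : HasDerivAt (fun s : ℝ => |s|) (Real.sign t) t := by
      rcases ht.lt_or_gt with h | h
      · simpa [Real.sign_of_neg h] using hasDerivAt_abs_neg h
      · simpa [Real.sign_of_pos h] using hasDerivAt_abs_pos h
    refine (((hasDerivAt_psiStar ha (ρ * |t|)).comp t
      (habs.const_mul ρ)).const_mul ρ⁻¹).congr_deriv ?_
    rw [← mul_assoc (a + 1)]
    field_simp

theorem dVarphi_eq {a ρ : ℝ} (ha : 1 < a) (hρ : 0 < ρ) (t : ℝ) :
    dVarphi a ρ t =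
      min 1 (max 0 (((a + 1) * ρ * |t| - 2) / (2 * (a - 1)))) * Real.sign t := by
  have h1 : 0 < ρ * (a + 1) := mul_pos hρ (by linarith)
  have h2 : 0 < 2 * (a - 1) := by linarith
  unfold dVarphi
  simp only [le_div_iff₀ h1]
  split_ifs with h h'
  · rw [max_eq_left (div_nonpos_of_nonpos_of_nonneg (by linarith) h2.le)]
    simp
  · rw [max_eq_right (div_nonneg (by linarith) h2.le),
      min_eq_right ((div_le_one h2).2 (by linarith))]
  · rw [max_eq_right (div_nonneg (by linarith) h2.le),
      min_eq_left ((one_le_div h2).2 (by linarith)), one_mul]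

/-- g_ρ is differentiable everywhere with gradient components
w_ρ(x)ᵢ · sign(xᵢ); equivalently the scalar function t ↦ ρ⁻¹ψ*_a(ρ|t|) is
differentiable with the indicated piecewise derivative. -/
theorem stmt5 {p : ℕ} (a ρ : ℝ) (ha : 1 < a) (hρ : 0 < ρ) :
    Differentiable ℝ (gRho (p := p) a ρ) ∧
    (∀ (x : Fin p → ℝ) (i : Fin p),
      HasDerivAt (fun t => gRho a ρ (Function.update x i t))
        (wRho a ρ x i * Real.sign (x i)) (x i)) ∧
    (∀ t : ℝ, HasDerivAt (fun s => ρ⁻¹ * psiStar a (ρ * |s|)) (dVarphi a ρ t) t) := by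
  refine ⟨?_, fun x i => ?_, fun t => ?_⟩
  · have h : gRho (p := p) a ρ = fun x => ∑ i, ρ⁻¹ * psiStar a (ρ * |x i|) :=
      funext fun x => Finset.mul_sum _ _ _
    rw [h]
    refine Differentiable.fun_sum fun i _ x => ?_
    exact DifferentiableAt.comp (g := fun s => ρ⁻¹ * psiStar a (ρ * |s|)) x
      (hasDerivAt_psiStar_abs ha hρ (x i)).differentiableAt (differentiableAt_apply i x)
  · have h : (fun t => gRho a ρ (Function.update x i t)) = fun t =>
        ρ⁻¹ * psiStar a (ρ * |t|) + ρ⁻¹ * ∑ j ∈ Finset.univ.erase i, psiStar a (ρ * |x j|) := by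
      ext t
      rw [gRho, ← Finset.add_sum_erase _ _ (Finset.mem_univ i), mul_add, Function.update_self]
      congr 2
      refine Finset.sum_congr rfl fun j hj => ?_
      rw [Function.update_of_ne (Finset.ne_of_mem_erase hj)]
    rw [h]
    exact (hasDerivAt_psiStar_abs ha hρ (x i)).add_const _
  · rw [dVarphi_eq ha hρ]
    exact hasDerivAt_psiStar_abs ha hρ t
end

section
/- Let a > 1 and ρ > 0, and let g_ρ(x) = ρ⁻¹ Σ_{i=1}^p ψ*_a(ρ|x_i|). Then with c = ρ(a+1)/(2(a−1)), the function x ↦ (c/2)‖x‖² − g_ρ(x) is convex on ℝ^p (i.e., −g_ρ is semiconvex with modulus at most c). Consequently, if f : ℝⁿ → ℝ is convex, A ∈ ℝ^{n×p}, b ∈ ℝⁿ, μ > 0, λ > 0, then x ↦ f(Ax−b) + (μ/2)‖x‖² + λ‖x‖₁ − λ g_ρ(x) + (λc/2)‖x‖² is convex on ℝ^p. -/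
open scoped BigOperators

/-- `psiStar` is a difference of two squared hinge functions. -/
lemma psiStar_eq_sq_max_sub_sq_max {a : ℝ} (ha : 1 < a) (s : ℝ) :
    psiStar a s = (a + 1) / (2 * (a - 1)) / 2 *
      (max (s - 2 / (a + 1)) 0 ^ 2 - max (s - 2 * a / (a + 1)) 0 ^ 2) := by
  have h1 : 0 < a - 1 := by linarith
  have h2 : 0 < a + 1 := by linarith
  have h3 : 2 / (a + 1) < 2 * a / (a + 1) := by gcongr; linarith
  have h4 : a ^ 2 - 1 = (a - 1) * (a + 1) := by ring
  unfold psiStar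
  split_ifs with hs ht
  · rw [max_eq_right (by linarith), max_eq_right (by linarith)]
    ring
  · rw [max_eq_left (by linarith), max_eq_right (by linarith), h4]
    field_simp
    ring
  · rw [max_eq_left (by linarith), max_eq_left (by linarith)]
    field_simp
    ring

/-- The Huber function, written as a square minus a squared hinge, is convex. -/
lemma convexOn_sq_sub_sq_max {α : ℝ} (hα : 0 ≤ α) :
    ConvexOn ℝ Set.univ (fun x : ℝ => x ^ 2 - max (|x| - α) 0 ^ 2) := by
  have minorant (m y : ℝ) (hm : |m| ≤ α) :
      2 * m * y - m ^ 2 ≤ y ^ 2 - max (|y| - α) 0 ^ 2 := by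
    have h : max (|y| - α) 0 ≤ |y - m| :=
      max_le (by linarith [abs_sub_abs_le_abs_sub y m]) (abs_nonneg _)
    have h' := pow_le_pow_left₀ (le_max_right _ _) h 2
    rw [sq_abs] at h'
    linarith
  have attained (z : ℝ) : ∃ m : ℝ, |m| ≤ α ∧
      z ^ 2 - max (|z| - α) 0 ^ 2 = 2 * m * z - m ^ 2 := by
    rcases le_total |z| α with h | h
    · refine ⟨z, h, ?_⟩
      rw [max_eq_right (by linarith)]
      ring
    · rcases abs_cases z with ⟨hz, _⟩ | ⟨hz, _⟩
      · refine ⟨α, (abs_of_nonneg hα).le, ?_⟩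
        rw [max_eq_left (by linarith), hz]
        ring
      · refine ⟨-α, by rw [abs_neg, abs_of_nonneg hα], ?_⟩
        rw [max_eq_left (by linarith), hz]
        ring
  refine ⟨convex_univ, fun x _ y _ s t hs ht hst => ?_⟩
  obtain ⟨m, hm, hz⟩ := attained (s • x + t • y)
  simp only [hz]
  simp only [smul_eq_mul]
  have hx := mul_le_mul_of_nonneg_left (minorant m x hm) hs
  have hy := mul_le_mul_of_nonneg_left (minorant m y hm) ht
  have hm2 : m ^ 2 = s * m ^ 2 + t * m ^ 2 := by rw [← add_mul, hst, one_mul]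
  linarith

lemma convexOn_abs : ConvexOn ℝ Set.univ (fun x : ℝ => |x|) :=
  convexOn_univ_norm (E := ℝ)

lemma convexOn_sq_max_abs_sub (β : ℝ) :
    ConvexOn ℝ Set.univ (fun x : ℝ => max (|x| - β) 0 ^ 2) :=
  ((convexOn_abs.sub (concaveOn_const β convex_univ)).sup
    (convexOn_const 0 convex_univ)).pow (fun _ _ => le_max_right _ _) 2

/-- Subtracting `psiStar` from the quadratic with its maximal curvature leaves a convex function. -/
lemma convexOn_sq_sub_psiStar_abs {a : ℝ} (ha : 1 < a) :
    ConvexOn ℝ Set.univ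
      (fun x : ℝ => (a + 1) / (2 * (a - 1)) / 2 * x ^ 2 - psiStar a |x|) := by
  have h1 : 0 < a - 1 := by linarith
  have h2 : 0 < a + 1 := by linarith
  refine (((convexOn_sq_sub_sq_max (α := 2 / (a + 1)) (by positivity)).add
    (convexOn_sq_max_abs_sub (2 * a / (a + 1)))).smul
    (c := (a + 1) / (2 * (a - 1)) / 2) (by positivity)).congr fun x _ => ?_
  rw [psiStar_eq_sq_max_sub_sq_max ha]
  simp only [Pi.add_apply, smul_eq_mul]
  ring

lemma convexOn_sq_sub_psiStar_scaled {a ρ : ℝ} (ha : 1 < a) (hρ : 0 < ρ) :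
    ConvexOn ℝ Set.univ (fun x : ℝ =>
      ρ * (a + 1) / (2 * (a - 1)) / 2 * x ^ 2 - ρ⁻¹ * psiStar a (ρ * |x|)) := by
  refine (((convexOn_sq_sub_psiStar_abs ha).comp_linearMap (LinearMap.mulLeft ℝ ρ)).smul
    (inv_nonneg.2 hρ.le)).congr fun x _ => ?_
  have h1 : a - 1 ≠ 0 := by linarith
  simp only [Function.comp_apply, LinearMap.mulLeft_apply, smul_eq_mul, abs_mul, abs_of_pos hρ]
  field_simp

/-- A separable sum of convex functions of one variable is convex. -/
lemma convexOn_sum_comp_apply {ι : Type*} [Fintype ι] {φ : ℝ → ℝ}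
    (hφ : ConvexOn ℝ Set.univ φ) :
    ConvexOn ℝ Set.univ (fun x : ι → ℝ => ∑ i, φ (x i)) := by
  refine ⟨convex_univ, fun x _ y _ s t hs ht hst => ?_⟩
  simp only [smul_eq_mul, Finset.mul_sum, ← Finset.sum_add_distrib]
  exact Finset.sum_le_sum fun i _ => hφ.2 (Set.mem_univ (x i)) (Set.mem_univ (y i)) hs ht hst

lemma convexOn_quadratic_sub_gRho {p : ℕ} {a ρ : ℝ} (ha : 1 < a) (hρ : 0 < ρ) :
    ConvexOn ℝ (Set.univ : Set (Fin p → ℝ))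
      (fun x => (ρ * (a + 1) / (2 * (a - 1))) / 2 * (∑ i, (x i) ^ 2) - gRho a ρ x) := by
  simpa only [gRho, Finset.mul_sum, Finset.sum_sub_distrib] using
    convexOn_sum_comp_apply (ι := Fin p) (convexOn_sq_sub_psiStar_scaled ha hρ)

/-- −g_ρ is semiconvex with modulus at most c = ρ(a+1)/(2(a−1)), and the
resulting shifted DC objective is convex. -/
theorem stmt7 {n p : ℕ} (a ρ : ℝ) (ha : 1 < a) (hρ : 0 < ρ) :
    ConvexOn ℝ (Set.univ : Set (Fin p → ℝ))
      (fun x => (ρ * (a + 1) / (2 * (a - 1))) / 2 * (∑ i, (x i) ^ 2) - gRho a ρ x) ∧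
    (∀ (f : (Fin n → ℝ) → ℝ), ConvexOn ℝ Set.univ f →
      ∀ (A : Matrix (Fin n) (Fin p) ℝ) (b : Fin n → ℝ) (μ lam : ℝ), 0 < μ → 0 < lam →
        ConvexOn ℝ (Set.univ : Set (Fin p → ℝ))
          (fun x => f (A.mulVec x - b) + μ / 2 * (∑ i, (x i) ^ 2) +
            lam * (∑ i, |x i|) - lam * gRho a ρ x +
            lam * (ρ * (a + 1) / (2 * (a - 1))) / 2 * (∑ i, (x i) ^ 2))) := by
  refine ⟨convexOn_quadratic_sub_gRho ha hρ, fun f hf A b μ lam hμ hlam => ?_⟩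
  have hfA : ConvexOn ℝ Set.univ (fun x : Fin p → ℝ => f (A.mulVec x - b)) :=
    hf.comp_affineMap (A.mulVecLin.toAffineMap - AffineMap.const ℝ (Fin p → ℝ) b)
  have hsq : ConvexOn ℝ Set.univ (fun x : Fin p → ℝ => ∑ i, (x i) ^ 2) :=
    convexOn_sum_comp_apply even_two.convexOn_pow
  have habs : ConvexOn ℝ Set.univ (fun x : Fin p → ℝ => ∑ i, |x i|) :=
    convexOn_sum_comp_apply convexOn_abs
  refine (((hfA.add (hsq.smul (half_pos hμ).le)).add (habs.smul hlam.le)).add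
    ((convexOn_quadratic_sub_gRho ha hρ).smul hlam.le)).congr fun x _ => ?_
  simp only [Pi.add_apply, smul_eq_mul]
  ring
end

section
/- Let a > 1 and ρ > 0, and let g_ρ(x) = ρ⁻¹ Σ_{i=1}^p ψ*_a(ρ|x_i|). Then for every x ∈ ℝ^p: (i) 0 ≤ ‖x‖₁ − g_ρ(x) ≤ p/ρ; (ii) if |x_i| ≥ 2a/(ρ(a+1)) for every index i with x_i ≠ 0, then ‖x‖₁ − g_ρ(x) = ‖x‖₀/ρ; (iii) consequently, if f : ℝⁿ → ℝ is nonnegative, A ∈ ℝ^{n×p}, b ∈ ℝⁿ, μ > 0, λ > 0, then Θ_{λ,ρ}(x) := f(Ax−b) + (μ/2)‖x‖² + λ‖x‖₁ − λ g_ρ(x) satisfies Θ_{λ,ρ}(x) ≥ (μ/2)‖x‖² for all x, so Θ_{λ,ρ} is bounded below and coercive. -/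
open scoped BigOperators

/-- The DC surrogate objective Θ_{λ,ρ}. -/
noncomputable def Theta {n p : ℕ} (f : (Fin n → ℝ) → ℝ) (A : Matrix (Fin n) (Fin p) ℝ)
    (b : Fin n → ℝ) (μ lam a ρ : ℝ) (x : Fin p → ℝ) : ℝ :=
  f (A.mulVec x - b) + μ / 2 * (∑ i, (x i) ^ 2) + lam * (∑ i, |x i|) - lam * gRho a ρ x

/-- For `s ≥ 0` the gap `s - ψ*_a(s)` is nonnegative. -/
theorem psiStar_le_self {a s : ℝ} (ha : 1 < a) (hs : 0 ≤ s) : psiStar a s ≤ s := by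
  have ha1 : 0 < a + 1 := by linarith
  unfold psiStar
  split_ifs with h1 h2
  · exact hs
  · rw [not_le, div_lt_iff₀ ha1] at h1
    rw [le_div_iff₀ ha1] at h2
    rw [div_le_iff₀ (by nlinarith)]
    nlinarith [mul_nonneg (sub_nonneg.2 h1.le) (sub_nonneg.2 h2)]
  · linarith

/-- The function `ψ*_a` dominates the line `s - 1`. -/
theorem sub_one_le_psiStar {a : ℝ} (ha : 1 < a) (s : ℝ) : s - 1 ≤ psiStar a s := by
  have ha1 : 0 < a + 1 := by linarith
  unfold psiStar
  split_ifs with h1 h2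
  · have : 2 / (a + 1) ≤ 1 := by rw [div_le_one ha1]; linarith
    linarith
  · rw [le_div_iff₀ (by nlinarith)]
    nlinarith [sq_nonneg ((a + 1) * s - 2 * a)]
  · exact le_rfl

theorem psiStar_eq_sub_one {a s : ℝ} (ha : 1 < a) (hs : 2 * a / (a + 1) ≤ s) :
    psiStar a s = s - 1 := by
  have ha1 : 0 < a + 1 := by linarith
  have h1 : ¬ s ≤ 2 / (a + 1) := by
    have : 2 / (a + 1) < 2 * a / (a + 1) := by gcongr; linarith
    linarith
  unfold psiStar
  rw [if_neg h1]
  split_ifs with h2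
  · have hu : (a + 1) * s = 2 * a := by
      rw [le_antisymm h2 hs]; field_simp
    rw [div_eq_iff (by nlinarith)]
    linear_combination ((a + 1) * s - 2 * a) * hu
  · rfl

theorem psiStar_zero {a : ℝ} (ha : 1 < a) : psiStar a 0 = 0 :=
  if_pos (by positivity)

/-- The gap `‖x‖₁ - g_ρ(x)` as a sum of coordinatewise gaps. -/
theorem sum_abs_sub_gRho {p : ℕ} (a : ℝ) {ρ : ℝ} (hρ : 0 < ρ) (x : Fin p → ℝ) :
    (∑ i, |x i|) - gRho a ρ x = (∑ i, (ρ * |x i| - psiStar a (ρ * |x i|))) / ρ := by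
  rw [gRho, Finset.sum_sub_distrib, ← Finset.mul_sum]
  field_simp

theorem gRho_le_sum_abs {p : ℕ} {a ρ : ℝ} (ha : 1 < a) (hρ : 0 < ρ) (x : Fin p → ℝ) :
    0 ≤ (∑ i, |x i|) - gRho a ρ x := by
  rw [sum_abs_sub_gRho a hρ]
  exact div_nonneg
    (Finset.sum_nonneg fun i _ => sub_nonneg.2 (psiStar_le_self ha (by positivity))) hρ.le

theorem sum_abs_sub_gRho_le {p : ℕ} {a ρ : ℝ} (ha : 1 < a) (hρ : 0 < ρ) (x : Fin p → ℝ) :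
    (∑ i, |x i|) - gRho a ρ x ≤ p / ρ := by
  rw [sum_abs_sub_gRho a hρ]
  gcongr
  calc ∑ i, (ρ * |x i| - psiStar a (ρ * |x i|)) ≤ ∑ _i : Fin p, (1 : ℝ) :=
        Finset.sum_le_sum fun i _ => by linarith [sub_one_le_psiStar ha (ρ * |x i|)]
    _ = p := by simp

theorem sum_abs_sub_gRho_eq {p : ℕ} {a ρ : ℝ} (ha : 1 < a) (hρ : 0 < ρ) (x : Fin p → ℝ)
    (hx : ∀ i, x i ≠ 0 → 2 * a / (ρ * (a + 1)) ≤ |x i|) :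
    (∑ i, |x i|) - gRho a ρ x = (znorm x : ℝ) / ρ := by
  have hcoord : ∀ i, ρ * |x i| - psiStar a (ρ * |x i|) = if x i ≠ 0 then 1 else 0 := by
    intro i
    split_ifs with h
    · have hi := hx i h
      rw [div_le_iff₀ (by positivity)] at hi
      rw [psiStar_eq_sub_one ha (by rw [div_le_iff₀ (by positivity)]; linarith)]
      ring
    · rw [not_not.1 h, abs_zero, mul_zero, psiStar_zero ha, sub_zero]
  rw [sum_abs_sub_gRho a hρ, Finset.sum_congr rfl fun i _ => hcoord i, Finset.sum_boole, znorm]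

theorem half_mul_sq_norm_le_Theta {n p : ℕ} {a ρ : ℝ} (ha : 1 < a) (hρ : 0 < ρ)
    {f : (Fin n → ℝ) → ℝ} (hf : ∀ z, 0 ≤ f z) (A : Matrix (Fin n) (Fin p) ℝ) (b : Fin n → ℝ)
    (μ : ℝ) {lam : ℝ} (hlam : 0 < lam) (x : Fin p → ℝ) :
    μ / 2 * (∑ i, (x i) ^ 2) ≤ Theta f A b μ lam a ρ x := by
  have h := mul_nonneg hlam.le (gRho_le_sum_abs ha hρ x)
  have hfx := hf (A.mulVec x - b)
  unfold Theta
  linarith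

/-- bounds relating ‖·‖₁ − g_ρ to the zero norm, and the lower bound
Θ_{λ,ρ}(x) ≥ (μ/2)‖x‖², hence Θ_{λ,ρ} is bounded below and coercive. -/
theorem stmt8 {n p : ℕ} (a ρ : ℝ) (ha : 1 < a) (hρ : 0 < ρ) :
    -- (i)
    (∀ x : Fin p → ℝ, 0 ≤ (∑ i, |x i|) - gRho a ρ x ∧
        (∑ i, |x i|) - gRho a ρ x ≤ p / ρ) ∧
    -- (ii)
    (∀ x : Fin p → ℝ, (∀ i, x i ≠ 0 → 2 * a / (ρ * (a + 1)) ≤ |x i|) →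
        (∑ i, |x i|) - gRho a ρ x = (znorm x : ℝ) / ρ) ∧
    -- (iii)
    (∀ (f : (Fin n → ℝ) → ℝ), (∀ z, 0 ≤ f z) →
      ∀ (A : Matrix (Fin n) (Fin p) ℝ) (b : Fin n → ℝ) (μ lam : ℝ), 0 < μ → 0 < lam →
        (∀ x : Fin p → ℝ, μ / 2 * (∑ i, (x i) ^ 2) ≤ Theta f A b μ lam a ρ x) ∧
        BddBelow (Set.range (Theta f A b μ lam a ρ)) ∧
        (∀ M : ℝ, ∃ R : ℝ, ∀ x : Fin p → ℝ, R ≤ Real.sqrt (∑ i, (x i) ^ 2) →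
          M ≤ Theta f A b μ lam a ρ x)) := by
  refine ⟨fun x => ⟨gRho_le_sum_abs ha hρ x, sum_abs_sub_gRho_le ha hρ x⟩,
    sum_abs_sub_gRho_eq ha hρ, fun f hf A b μ lam hμ hlam => ?_⟩
  have hlow := half_mul_sq_norm_le_Theta ha hρ hf A b μ hlam
  refine ⟨hlow, ⟨0, ?_⟩, fun M => ⟨√(2 * |M| / μ), fun x hx => ?_⟩⟩
  · rintro _ ⟨x, rfl⟩
    exact le_trans (by positivity) (hlow x)
  · have hsq : 2 * |M| / μ ≤ ∑ i, (x i) ^ 2 := (Real.sqrt_le_sqrt_iff (by positivity)).1 hx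
    rw [div_le_iff₀ hμ] at hsq
    linarith [hlow x, le_abs_self M]
end
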